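/- Let a, b, c, μ ∈ ℂ with Re c > 0 and Re μ > 0, and assume neither c nor c+μ is a nonpositive integer. Then for every real x ∈ (-∞,0) ∪ (0,1), one has ∫_I |y|^{c-1} F(a,b;c;y) · |x-y|^{μ-1}/Γ(μ) dy = (Γ(c)/Γ(c+μ)) · |x|^{c+μ-1} · F(a,b;c+μ;x), where I is the open interval with endpoints 0 and x (this is the fractional integral transformation of type c+, Bateman's fractional integral formula in unified form). -/

import Mathlib

open MeasureTheory Set Complex Filter

/-- Pochhammer symbol `(a)_k = a (a+1) ⋯ (a+k-1)`. -/
noncomputable def poch (a : ℂ) (k : ℕ) : ℂ := ∏ i ∈ Finset.range k, (a + i)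

/-- The Gauss hypergeometric function `F(a,b;c;x)` for real `x < 1`, defined by the
power series on `[0,1)` and by the (agreeing) Pfaff series for `x < 0`. -/
noncomputable def hypF (a b c : ℂ) (x : ℝ) : ℂ :=
  if 0 ≤ x then
    ∑' k : ℕ, poch a k * poch b k / (poch c k * (Nat.factorial k : ℂ)) * (x : ℂ) ^ k
  else
    ((1 - x : ℝ) : ℂ) ^ (-a) *
      ∑' k : ℕ, poch a k * poch (c - b) k / (poch c k * (Nat.factorial k : ℂ)) *
        (((x / (x - 1) : ℝ)) : ℂ) ^ k

noncomputable def gb (a : ℂ) (n : ℕ) : ℂ := poch a n / (Nat.factorial n : ℂ)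

lemma poch_zero (a : ℂ) : poch a 0 = 1 := by simp [poch]

lemma poch_succ (a : ℂ) (n : ℕ) : poch a (n+1) = poch a n * (a + n) := by
  simp [poch, Finset.prod_range_succ]

lemma poch_eq (a : ℂ) (n : ℕ) : poch a n = (ascPochhammer ℂ n).eval a := by
  induction n with
  | zero => simp [poch]
  | succ n ih => rw [poch_succ, ih, ascPochhammer_succ_eval]

lemma poch_add (a : ℂ) (m n : ℕ) : poch a (m+n) = poch a m * poch (a+m) n := by
  simp only [poch, Finset.prod_range_add]
  congr 1
  refine Finset.prod_congr rfl fun i _ => ?_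
  push_cast; ring

lemma poch_refl (x : ℂ) (m : ℕ) : poch x m = (-1)^m * poch (1 - x - m) m := by
  simp only [poch]
  rw [← Finset.prod_range_reflect]
  have h : ((-1 : ℂ))^m = ∏ _i ∈ Finset.range m, (-1 : ℂ) := by simp
  rw [h, ← Finset.prod_mul_distrib]
  refine Finset.prod_congr rfl fun i hi => ?_
  have : i < m := Finset.mem_range.1 hi
  rw [Nat.cast_sub (by omega), Nat.cast_sub (by omega)]
  push_cast; ring

lemma gb_choose' (a : ℂ) (n : ℕ) : gb a n = Ring.choose (a + n - 1) n := by
  rw [← Ring.multichoose_eq]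
  have h := Ring.factorial_nsmul_multichoose_eq_ascPochhammer a n
  rw [Polynomial.ascPochhammer_smeval_eq_eval, ← poch_eq, nsmul_eq_mul] at h
  rw [gb, ← h, mul_div_cancel_left₀]
  exact_mod_cast Nat.factorial_ne_zero n

lemma gb_choose (a : ℂ) (n : ℕ) : gb a n = (-1)^n * Ring.choose (-a) n := by
  rw [gb_choose', Ring.choose_neg, Units.smul_def, zsmul_eq_mul, ← mul_assoc]
  simp [← mul_pow]

lemma vand (x y : ℂ) (n : ℕ) :
    gb (x+y) n = ∑ p ∈ Finset.HasAntidiagonal.antidiagonal n, gb x p.1 * gb y p.2 := by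
  rw [gb_choose, neg_add, Ring.add_choose_eq _ (Commute.all _ _), Finset.mul_sum]
  refine Finset.sum_congr rfl fun p hp => ?_
  rw [gb_choose, gb_choose, ← Finset.HasAntidiagonal.mem_antidiagonal.1 hp, pow_add]; ring

lemma vand2 (b c : ℂ) (k : ℕ) :
    gb (c-b) k = ∑ p ∈ Finset.HasAntidiagonal.antidiagonal k, (-1)^p.1 * gb b p.1 * gb (c + p.1) p.2 := by
  have h : gb (c-b) k = (-1)^k * gb (b + (1 - c - k)) k := by
    rw [gb, poch_refl, gb]
    rw [show 1 - (c-b) - k = b + (1 - c - k) by ring]; ring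
  rw [h, vand, Finset.mul_sum]
  refine Finset.sum_congr rfl fun p hp => ?_
  have hp := Finset.HasAntidiagonal.mem_antidiagonal.1 hp
  rw [gb, gb, gb, poch_refl (c + p.1)]
  rw [show 1 - (c + p.1) - p.2 = 1 - c - (k:ℂ) by rw [← hp]; push_cast; ring]
  rw [← hp, pow_add]; ring

noncomputable def PP (a b c d : ℂ) (n : ℕ) : ℂ :=
  ∑ p ∈ Finset.HasAntidiagonal.antidiagonal n, poch (c + p.1) p.2 * gb (d - a) p.2 * poch a p.1 * gb (c-b) p.1

lemma sum_triple (f : ℕ → ℕ → ℕ → ℂ) (n : ℕ) :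
    ∑ p ∈ Finset.HasAntidiagonal.antidiagonal n, ∑ q ∈ Finset.HasAntidiagonal.antidiagonal p.1,
      f q.1 q.2 p.2 =
    ∑ p ∈ Finset.HasAntidiagonal.antidiagonal n, ∑ q ∈ Finset.HasAntidiagonal.antidiagonal p.2,
      f p.1 q.1 q.2 := by
  rw [Finset.sum_sigma', Finset.sum_sigma']
  refine Finset.sum_nbij' (fun x => ⟨(x.2.1, x.2.2 + x.1.2), (x.2.2, x.1.2)⟩)
    (fun x => ⟨(x.1.1 + x.2.1, x.2.2), (x.1.1, x.2.1)⟩) ?_ ?_ ?_ ?_ ?_ <;>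
  · rintro ⟨⟨i, j⟩, ⟨k, l⟩⟩ h
    simp only [Finset.mem_sigma, Finset.HasAntidiagonal.mem_antidiagonal] at h ⊢
    try obtain ⟨h1, h2⟩ := h
    try subst h2
    try subst h1
    try simp [add_assoc]

lemma PP_eq (a b c d : ℂ) (n : ℕ) : PP a b c d n =
    ∑ p ∈ Finset.HasAntidiagonal.antidiagonal n, (-1)^p.1 * gb b p.1 * poch a p.1 * poch (c + p.1) p.2 *
      gb (d + p.1) p.2 := by
  have h1 : PP a b c d n = ∑ p ∈ Finset.HasAntidiagonal.antidiagonal n, ∑ q ∈ Finset.HasAntidiagonal.antidiagonal p.1,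
      ((-1)^q.1 * gb b q.1 * poch a q.1 * poch (c + q.1) (q.2 + p.2)) *
       (gb (a + q.1) q.2 * gb (d - a) p.2) := by
    unfold PP
    apply Finset.sum_congr rfl
    intro p hp
    rw [vand2 b c, Finset.mul_sum]
    refine Finset.sum_congr rfl fun q hq => ?_
    have hq := Finset.HasAntidiagonal.mem_antidiagonal.1 hq
    rw [← hq, poch_add, poch_add (c + q.1), gb, gb, gb, gb]
    push_cast
    rw [add_assoc c]; ring
  rw [h1, sum_triple (fun j m l => ((-1)^j * gb b j * poch a j * poch (c + j) (m + l)) *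
       (gb (a + j) m * gb (d - a) l))]
  refine Finset.sum_congr rfl fun p hp => ?_
  rw [show d + (p.1 : ℂ) = (a + p.1) + (d - a) by ring, vand, Finset.mul_sum]
  refine Finset.sum_congr rfl fun q hq => ?_
  rw [Finset.HasAntidiagonal.mem_antidiagonal.1 hq]

lemma PP_symm (a b c d : ℂ) (n : ℕ) : PP a b c d n = PP a b d c n := by
  rw [PP_eq, PP_eq]
  refine Finset.sum_congr rfl fun p hp => ?_
  rw [gb, gb, gb]; ring

lemma poch_ne {c : ℂ} (hc : ∀ n : ℕ, c ≠ -(n : ℂ)) (n : ℕ) : poch c n ≠ 0 := by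
  rw [poch, Finset.prod_ne_zero_iff]
  intro i _ h
  exact hc i (eq_neg_of_add_eq_zero_left h)

noncomputable def hc (a b c : ℂ) (k : ℕ) : ℂ := poch a k * poch b k / (poch c k * (Nat.factorial k : ℂ))

lemma cauchy_coeff (a b c d : ℂ) (h : ∀ n : ℕ, c ≠ -(n : ℂ)) (n : ℕ) :
    poch c n * ∑ p ∈ Finset.HasAntidiagonal.antidiagonal n, hc a (c-b) c p.1 * gb (d-a) p.2 = PP a b c d n := by
  rw [PP, Finset.mul_sum]
  refine Finset.sum_congr rfl fun p hp => ?_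
  have hp := Finset.HasAntidiagonal.mem_antidiagonal.1 hp
  rw [← hp, poch_add, hc, gb, gb]
  have := poch_ne h p.1
  field_simp

lemma ratio_tendsto (a c : ℂ) : Tendsto (fun k : ℕ => (a + k) / (c + k)) atTop (nhds 1) := by
  have h : ∀ a : ℂ, Tendsto (fun k : ℕ => a / (k : ℂ) + 1) atTop (nhds 1) := fun a => by
    simpa using (tendsto_const_div_atTop_nhds_zero_nat a).add_const 1
  have h2 := (h a).div (h c) one_ne_zero
  rw [div_one] at h2
  refine h2.congr' ?_
  filter_upwards [eventually_gt_atTop 0] with k hk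
  have : (k : ℂ) ≠ 0 := by exact_mod_cast hk.ne'
  simp only [Pi.div_apply]
  rw [div_add_one this, div_add_one this, div_div_div_cancel_right₀ this]

lemma hc_summable (a b c : ℂ) (r : ℝ) (hr0 : 0 ≤ r) (hr : r < 1) :
    Summable fun k => ‖hc a b c k‖ * r ^ k := by
  obtain ⟨s, hs1, hs2⟩ := exists_between hr
  have ht : Tendsto (fun k : ℕ => ‖(a + k) / (c + k) * ((b + k) / (1 + k))‖ * r) atTop (nhds r) := by
    simpa using (((ratio_tendsto a c).mul (ratio_tendsto b 1)).norm.mul_const r)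
  refine summable_of_ratio_norm_eventually_le hs2 ?_
  filter_upwards [ht.eventually_lt_const hs1] with k hk
  have e : hc a b c (k+1) = hc a b c k * ((a + k) / (c + k) * ((b + k) / (1 + k))) := by
    simp only [hc, poch_succ, Nat.factorial_succ]
    push_cast
    rw [add_comm (1:ℂ), div_mul_div_comm, div_mul_div_comm]
    congr 1 <;> ring
  rw [Real.norm_of_nonneg (by positivity), Real.norm_of_nonneg (by positivity), e, norm_mul (hc a b c k), pow_succ]
  calc _ = (‖(a + k) / (c + k) * ((b + k) / (1 + k))‖ * r) * (‖hc a b c k‖ * r^k) := by ring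
    _ ≤ _ := by gcongr

lemma gb_eq_hc (a : ℂ) (k : ℕ) : gb a k = hc a 1 1 k := by
  have : poch 1 k ≠ 0 := poch_ne (fun n h => by
    have h2 := congrArg Complex.re h
    simp at h2
    have : (0:ℝ) ≤ n := by positivity
    linarith) k
  rw [gb, hc]; field_simp

lemma binom_series (a : ℂ) (u : ℝ) (h0 : 0 ≤ u) (h1 : u < 1) :
    ∑' n, gb a n * (u:ℂ)^n = ((1 - u : ℝ) : ℂ) ^ (-a) := by
  have h := (Complex.one_div_one_sub_cpow_hasFPowerSeriesOnBall_zero a).hasSum (y := (u:ℂ)) (by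
    rw [Metric.mem_eball, edist_zero_right, ← ofReal_norm, ENNReal.ofReal_lt_one]
    simpa [abs_of_nonneg h0] using h1)
  simp only [zero_add, FormalMultilinearSeries.ofScalars_apply_eq, smul_eq_mul, ← gb_choose'] at h
  rw [h.tsum_eq, Complex.cpow_neg, one_div]
  push_cast; rfl

lemma cauchy (a b c d : ℂ) (u : ℝ) (h0 : 0 ≤ u) (h1 : u < 1) :
    (∑' n, hc a b c n * (u:ℂ)^n) * ((1 - u : ℝ) : ℂ) ^ (-d) =
    ∑' n, (∑ p ∈ Finset.HasAntidiagonal.antidiagonal n, hc a b c p.1 * gb d p.2) * (u:ℂ)^n := by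
  rw [← binom_series d u h0 h1, tsum_mul_tsum_eq_tsum_sum_antidiagonal_of_summable_norm]
  · congr 1; ext n
    rw [Finset.sum_mul]
    refine Finset.sum_congr rfl fun p hp => ?_
    rw [← Finset.HasAntidiagonal.mem_antidiagonal.1 hp, pow_add]; ring
  · simpa [abs_of_nonneg h0] using hc_summable a b c u h0 h1
  · simpa [abs_of_nonneg h0, gb_eq_hc] using hc_summable d 1 1 u h0 h1

lemma cauchy_summable (a b c d : ℂ) (u : ℝ) (h0 : 0 ≤ u) (h1 : u < 1) :
    Summable fun n => ‖∑ p ∈ Finset.HasAntidiagonal.antidiagonal n, hc a b c p.1 * gb d p.2‖ * u^n := by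
  have := summable_norm_sum_mul_antidiagonal_of_summable_norm
    (f := fun n => hc a b c n * (u:ℂ)^n) (g := fun n => gb d n * (u:ℂ)^n)
    (by simpa [abs_of_nonneg h0] using hc_summable a b c u h0 h1)
    (by simpa [abs_of_nonneg h0, gb_eq_hc] using hc_summable d 1 1 u h0 h1)
  refine this.congr fun n => ?_
  rw [← Real.norm_of_nonneg (pow_nonneg h0 n), ← norm_real, ← norm_mul, Finset.sum_mul]
  congr 1
  refine Finset.sum_congr rfl fun p hp => ?_
  rw [← Finset.HasAntidiagonal.mem_antidiagonal.1 hp]; push_cast; ring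

lemma beta_int {c μ : ℂ} (h1 : 0 < c.re) (h2 : 0 < μ.re) {w : ℝ} (hw : 0 < w) :
    IntegrableOn (fun u : ℝ => (u:ℂ)^(c-1) * ((w:ℂ) - u)^(μ-1)) (Ioo 0 w) := by
  have h := (Complex.betaIntegral_convergent h1 h2).comp_mul_left (c := w⁻¹)
  rw [zero_div, div_inv_eq_mul, one_mul, intervalIntegrable_iff_integrableOn_Ioo_of_le hw.le] at h
  have h' : IntegrableOn _ (Ioo 0 w) := h.const_mul ((w:ℂ)^(c-1) * (w:ℂ)^(μ-1))
  refine h'.congr_fun ?_ measurableSet_Ioo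
  intro u hu
  simp only
  have e1 : (u:ℂ)^(c-1) = (w:ℂ)^(c-1) * ((w⁻¹ * u : ℝ) : ℂ)^(c-1) := by
    rw [← Complex.mul_cpow_ofReal_nonneg hw.le (by have := hu.1; positivity), ← ofReal_mul]
    congr 2; field_simp
  have e2 : ((w:ℂ) - u)^(μ-1) = (w:ℂ)^(μ-1) * (1 - ((w⁻¹ * u : ℝ) : ℂ))^(μ-1) := by
    rw [show (1:ℂ) - ((w⁻¹ * u : ℝ) : ℂ) = ((1 - w⁻¹ * u : ℝ) : ℂ) by push_cast; ring,
      ← Complex.mul_cpow_ofReal_nonneg hw.le, ← ofReal_mul, ← ofReal_sub]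
    · congr 2; field_simp
    · have := hu.2
      rw [sub_nonneg, inv_mul_le_one₀ hw]; exact this.le
  rw [e1, e2]; ring

lemma Gamma_add_poch {c : ℂ} (h : 0 < c.re) (n : ℕ) : Gamma (c + n) = poch c n * Gamma c := by
  induction n with
  | zero => simp [poch]
  | succ n ih =>
    rw [poch_succ, Nat.cast_succ, ← add_assoc, Gamma_add_one, ih]
    · ring
    · intro h2
      have := congrArg Complex.re h2
      simp at this
      have : (0:ℝ) ≤ n := by positivity
      linarith

lemma cpow_addnat (x s : ℂ) (n : ℕ) (hx : x ≠ 0) : x ^ (s + n) = x ^ s * x ^ n := by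
  rw [cpow_add _ _ hx, cpow_natCast]

lemma beta_val {c μ : ℂ} (h1 : 0 < c.re) (h2 : 0 < μ.re) {w : ℝ} (hw : 0 < w) (n : ℕ) :
    ∫ u in Ioo 0 w, (u:ℂ)^(c-1) * (u:ℂ)^n * ((w:ℂ) - u)^(μ-1) =
     Gamma c * Gamma μ / Gamma (c + μ) * (w:ℂ)^(c+μ-1) * (poch c n / poch (c+μ) n * (w:ℂ)^n) := by
  have h1' : 0 < (c + n).re := by simp; positivity
  have h3 : 0 < (c + μ).re := by simp; positivity
  have e : ∫ u in Ioo 0 w, (u:ℂ)^(c-1) * (u:ℂ)^n * ((w:ℂ) - u)^(μ-1) =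
      ∫ u in (0:ℝ)..w, (u:ℂ)^((c+n)-1) * ((w:ℂ) - u)^(μ-1) := by
    rw [intervalIntegral.integral_of_le hw.le, ← integral_Ioc_eq_integral_Ioo]
    refine setIntegral_congr_fun measurableSet_Ioc fun u hu => ?_
    rw [show c + n - 1 = (c - 1) + n by ring, cpow_addnat]
    exact_mod_cast hu.1.ne'
  rw [e, betaIntegral_scaled _ _ hw]
  have hb := Gamma_mul_Gamma_eq_betaIntegral h1' h2
  rw [show c + n + μ = c + μ + n by ring, Gamma_add_poch h1, Gamma_add_poch h3] at hb
  have g := Gamma_ne_zero_of_re_pos h3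
  have p : poch (c + μ) n ≠ 0 := by
    intro h0
    have h4 : 0 < (c + μ + n).re := by simp; rw [add_re] at h3; positivity
    have := Gamma_ne_zero_of_re_pos h4
    rw [Gamma_add_poch h3, h0] at this
    simp at this
  rw [show c + n + μ - 1 = (c + μ - 1) + n by ring, cpow_addnat _ _ _ (by exact_mod_cast hw.ne')]
  field_simp
  linear_combination -((w:ℂ)^(c+μ-1) * (w:ℂ)^n) * hb

lemma termwise {c μ : ℂ} (h1 : 0 < c.re) (h2 : 0 < μ.re) {w : ℝ} (hw : 0 < w) (e : ℕ → ℂ)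
    (he : Summable fun n => ‖e n‖ * w^n) :
    ∫ u in Ioo 0 w, (u:ℂ)^(c-1) * (∑' n, e n * (u:ℂ)^n) * ((w:ℂ) - u)^(μ-1) =
     Gamma c * Gamma μ / Gamma (c + μ) * (w:ℂ)^(c+μ-1) *
      ∑' n, e n * (poch c n / poch (c+μ) n) * (w:ℂ)^n := by
  have hb := beta_int h1 h2 hw
  have key := integral_tsum_of_summable_integral_norm (μ := volume.restrict (Ioo 0 w))
    (F := fun n u => e n * ((u:ℂ)^(c-1) * (u:ℂ)^n * ((w:ℂ) - u)^(μ-1))) ?_ ?_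
  · have e1 : ∫ u in Ioo 0 w, (u:ℂ)^(c-1) * (∑' n, e n * (u:ℂ)^n) * ((w:ℂ) - u)^(μ-1) =
      ∫ u in Ioo 0 w, ∑' n, e n * ((u:ℂ)^(c-1) * (u:ℂ)^n * ((w:ℂ) - u)^(μ-1)) := by
      congr 1; ext u
      rw [← tsum_mul_left, ← tsum_mul_right]
      congr 1; ext n; ring
    rw [e1, ← key, ← tsum_mul_left]
    congr 1; ext n
    rw [integral_const_mul, beta_val h1 h2 hw]; ring
  · intro n
    have : IntegrableOn (fun u : ℝ => (u:ℂ)^(c-1) * (u:ℂ)^n * ((w:ℂ) - u)^(μ-1)) (Ioo 0 w) := by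
      refine (beta_int (c := c + n) (by simp; positivity) h2 hw).congr_fun ?_ measurableSet_Ioo
      intro u hu
      beta_reduce
      rw [show c + n - 1 = (c - 1) + n by ring, cpow_addnat]
      exact_mod_cast hu.1.ne'
    exact this.const_mul _
  · refine Summable.of_nonneg_of_le (fun n => integral_nonneg fun u => norm_nonneg _) (fun n => ?_)
      (he.mul_right (∫ u in Ioo 0 w, ‖(u:ℂ)^(c-1) * ((w:ℂ) - u)^(μ-1)‖))
    rw [← integral_const_mul]
    refine integral_mono_of_nonneg (.of_forall fun u => norm_nonneg _) (hb.norm.const_mul _) ?_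
    refine (ae_restrict_iff' measurableSet_Ioo).2 (.of_forall fun u hu => ?_)
    simp only
    calc _ = ‖e n‖ * u^n * ‖(u:ℂ)^(c-1) * ((w:ℂ) - u)^(μ-1)‖ := by
          simp only [norm_mul, norm_pow, norm_real, Real.norm_of_nonneg hu.1.le]; ring
      _ ≤ _ := by
          have := hu.1.le
          have := hu.2.le
          gcongr

lemma cp {r : ℝ} (h : 0 < r) (s : ℂ) : (r:ℂ)^s = cexp (s * (Real.log r : ℝ)) := by
  rw [cpow_def_of_ne_zero (by exact_mod_cast h.ne'), ← ofReal_log h.le, mul_comm]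

/-- Bateman's fractional integral formula (type `c+`), in unified form. -/
theorem stmt_0 (a b c μ : ℂ) (hc : 0 < c.re) (hμ : 0 < μ.re)
    (hc1 : ∀ n : ℕ, c ≠ -(n : ℂ)) (hc2 : ∀ n : ℕ, c + μ ≠ -(n : ℂ))
    (x : ℝ) (hx : x < 0 ∨ (0 < x ∧ x < 1)) :
    ∫ y in uIoo 0 x,
        ((|y| : ℝ) : ℂ) ^ (c - 1) * hypF a b c y *
          (((|x - y| : ℝ) : ℂ) ^ (μ - 1) / Complex.Gamma μ)
      = Complex.Gamma c / Complex.Gamma (c + μ) * ((|x| : ℝ) : ℂ) ^ (c + μ - 1) *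
        hypF a b (c + μ) x := by
  have gμ := Gamma_ne_zero_of_re_pos hμ
  rcases hx with hx | ⟨hx0, hx1⟩
  · have hw0 : 0 < x / (x - 1) := div_pos_of_neg_of_neg hx (by linarith)
    have hw1 : x / (x - 1) < 1 := by rw [div_lt_one_of_neg (by linarith)]; linarith
    obtain ⟨w, hw⟩ : ∃ w, w = x / (x - 1) := ⟨_, rfl⟩
    rw [← hw] at hw0 hw1
    have hxw : x = w / (w - 1) := by
      have : x - 1 ≠ 0 := by linarith
      have : w - 1 ≠ 0 := by linarith
      rw [eq_div_iff this, hw]; field_simp; ring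
    have himg : (fun u : ℝ => u / (u - 1)) '' Ioo 0 w = uIoo 0 x := by
      rw [uIoo_of_gt hx]
      ext y
      constructor
      · rintro ⟨u, ⟨h0, h1⟩, rfl⟩
        refine ⟨?_, div_neg_of_pos_of_neg h0 (by linarith)⟩
        have e : u / (u - 1) - x = (w - u) / ((1 - w) * (1 - u)) := by
          have : w - 1 ≠ 0 := by linarith
          have : 1 - w ≠ 0 := by linarith
          have : u - 1 ≠ 0 := by linarith
          have : 1 - u ≠ 0 := by linarith
          rw [hxw]; field_simp; ring
        have : 0 < (w - u) / ((1 - w) * (1 - u)) :=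
          div_pos (by linarith) (mul_pos (by linarith) (by linarith))
        simp only; linarith
      · rintro ⟨h0, h1⟩
        refine ⟨y / (y - 1), ⟨div_pos_of_neg_of_neg h1 (by linarith), ?_⟩, ?_⟩
        · have e : w - y / (y - 1) = (y - x) / ((1 - x) * (1 - y)) := by
            have : x - 1 ≠ 0 := by linarith
            have : 1 - x ≠ 0 := by linarith
            have : y - 1 ≠ 0 := by linarith
            have : 1 - y ≠ 0 := by linarith
            rw [hw]; field_simp; ring
          have : 0 < (y - x) / ((1 - x) * (1 - y)) :=
            div_pos (by linarith) (mul_pos (by linarith) (by linarith))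
          linarith
        · have : y - 1 ≠ 0 := by linarith
          simp only; field_simp; ring
    have hinj : InjOn (fun u : ℝ => u / (u - 1)) (Ioo 0 w) := by
      intro u hu v hv h
      have : u - 1 ≠ 0 := by have := hu.2; linarith
      have : v - 1 ≠ 0 := by have := hv.2; linarith
      beta_reduce at h
      field_simp at h
      linarith
    have hder : ∀ u ∈ Ioo 0 w, HasDerivWithinAt (fun u : ℝ => u / (u - 1)) (-(1 / (1 - u)^2))
        (Ioo 0 w) u := by
      intro u hu
      have h1 : u - 1 ≠ 0 := by have := hu.2; linarith
      have h2 : 1 - u ≠ 0 := by have := hu.2; linarith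
      have := ((hasDerivAt_id u).div ((hasDerivAt_id u).sub_const 1) h1).hasDerivWithinAt (s := Ioo 0 w)
      have e : -(1 / (1 - u) ^ 2) = (1 * (id u - 1) - id u * 1) / (id u - 1) ^ 2 := by
        simp only [id]
        rw [show (1 - u)^2 = (u - 1)^2 by ring]
        field_simp
        ring
      rw [e]
      exact this
    rw [← himg, integral_image_eq_integral_abs_deriv_smul measurableSet_Ioo hder hinj]
    set E : ℕ → ℂ := fun n => ∑ p ∈ Finset.HasAntidiagonal.antidiagonal n,
      _root_.hc a (c-b) c p.1 * gb (c+μ-a) p.2 with hE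
    have hT := termwise hc hμ hw0 E (cauchy_summable _ _ _ _ w hw0.le hw1)
    have hint : ∫ u in Ioo 0 w, |(-(1 / (1 - u)^2))| • (((|u / (u - 1)| : ℝ) : ℂ) ^ (c - 1) *
        hypF a b c (u / (u - 1)) * (((|x - u / (u - 1)| : ℝ) : ℂ) ^ (μ - 1) / Complex.Gamma μ)) =
        ∫ u in Ioo 0 w, (((1 - w : ℝ) : ℂ)^(1 - μ) / Gamma μ) *
          ((u:ℂ)^(c-1) * (∑' n, E n * (u:ℂ)^n) * ((w:ℂ) - u)^(μ-1)) := by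
      refine setIntegral_congr_fun measurableSet_Ioo fun u hu => ?_
      have hu0 := hu.1
      have hu1 : 0 < 1 - u := by linarith [hu.2]
      have hw1' : 0 < 1 - w := by linarith
      have hwu : 0 < w - u := by linarith [hu.2]
      have : u - 1 ≠ 0 := by linarith
      have : w - 1 ≠ 0 := by linarith
      have a1 : |(-(1 / (1 - u)^2))| = ((1 - u)^2)⁻¹ := by
        rw [abs_neg, abs_of_pos (by positivity), one_div]
      have a2 : |u / (u - 1)| = u / (1 - u) := by
        rw [abs_of_neg (div_neg_of_pos_of_neg hu0 (by linarith)), ← div_neg, neg_sub]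
      have a3 : |x - u / (u - 1)| = (w - u) / ((1 - w) * (1 - u)) := by
        rw [abs_sub_comm, ← abs_of_pos (show 0 < (w - u) / ((1 - w) * (1 - u)) by positivity), hxw]
        congr 1; field_simp; ring
      have a4 : 1 - u / (u - 1) = (1 - u)⁻¹ := by field_simp; ring
      have a5 : (u / (u - 1)) / (u / (u - 1) - 1) = u := by field_simp; ring
      have a6 : ¬ (0 ≤ u / (u - 1)) := not_le.2 (div_neg_of_pos_of_neg hu0 (by linarith))
      have hca := cauchy a (c-b) c (c+μ-a) u hu0.le (by linarith)
      simp only [_root_.hc] at hca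
      simp only [hypF, a6, if_false, a1, a2, a3, a4, a5, hE, _root_.hc]
      rw [← hca, ← ofReal_sub, real_smul]
      have a7 : ((((1 - u)^2)⁻¹ : ℝ) : ℂ) = cexp (-2 * (Real.log (1 - u) : ℝ)) := by
        rw [show (-2 * (Real.log (1 - u) : ℝ) : ℂ) = ((-2 * Real.log (1 - u) : ℝ) : ℂ) by push_cast; ring,
          ← ofReal_exp, mul_comm, ← Real.rpow_def_of_pos hu1, Real.rpow_neg hu1.le]
        norm_cast
      rw [a7, cp (by positivity), cp (by positivity), cp (by positivity), cp (by positivity),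
        cp (by positivity), cp (by positivity), cp (by positivity)]
      rw [Real.log_div hu0.ne' hu1.ne', Real.log_inv, Real.log_div hwu.ne' (by positivity),
        Real.log_mul hw1'.ne' hu1.ne']
      generalize (∑' k : ℕ, poch a k * poch (c - b) k / (poch c k * (Nat.factorial k : ℂ)) * (u:ℂ)^k) = S
      push_cast
      generalize (Real.log u : ℂ) = L1
      generalize (Real.log (1-u) : ℂ) = L2
      generalize (Real.log (w-u) : ℂ) = L3
      generalize (Real.log (1-w) : ℂ) = L4
      have : cexp (-2 * L2) * cexp ((c-1) * (L1 - L2)) * cexp (-a * -L2) * cexp ((μ-1) * (L3 - (L4 + L2)))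
        = cexp ((1-μ)*L4) * cexp ((c-1)*L1) * cexp (-(c+μ-a)*L2) * cexp ((μ-1)*L3) := by
        simp only [← Complex.exp_add]
        congr 1; ring
      linear_combination (S / Gamma μ) * this
    rw [hint, integral_const_mul, hT]
    have hcoef : ∀ n, E n * (poch c n / poch (c+μ) n) =
        ∑ p ∈ Finset.HasAntidiagonal.antidiagonal n, _root_.hc a (c+μ-b) (c+μ) p.1 * gb (c-a) p.2 := by
      intro n
      have h1 := cauchy_coeff a b c (c+μ) hc1 n
      have h2 := cauchy_coeff a b (c+μ) c hc2 n
      rw [PP_symm] at h2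
      have p2 := poch_ne hc2 n
      rw [← mul_div_assoc, div_eq_iff p2, mul_comm (E n), h1, mul_comm _ (poch (c+μ) n), h2]
    simp only [hcoef]
    rw [← cauchy _ _ _ _ w hw0.le hw1]
    have a2 : |x| = w / (1 - w) := by
      rw [abs_of_neg hx, hxw, ← div_neg, neg_sub]
    have : w - 1 ≠ 0 := by linarith
    have hw1' : 0 < 1 - w := by linarith
    have a4 : 1 - x = (1 - w)⁻¹ := by rw [hxw]; field_simp; ring
    rw [hypF, if_neg (not_le.2 hx), ← hw, a2, a4]
    simp only [_root_.hc]
    rw [cp (by positivity), cp (by positivity), cp (by positivity), cp (by positivity),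
        cp (by positivity)]
    rw [Real.log_div hw0.ne' hw1'.ne', Real.log_inv]
    generalize (∑' k : ℕ, poch a k * poch (c + μ - b) k / (poch (c+μ) k * (Nat.factorial k : ℂ)) * (w:ℂ)^k) = S
    push_cast
    generalize (Real.log w : ℂ) = L1
    generalize (Real.log (1-w) : ℂ) = L2
    have : cexp ((1-μ)*L2) * cexp ((c+μ-1)*L1) * cexp (-(c-a)*L2) =
       cexp ((c+μ-1)*(L1-L2)) * cexp (-a * -L2) := by
        simp only [← Complex.exp_add]
        congr 1; ring
    have g2 : Gamma μ * (Gamma μ)⁻¹ = 1 := mul_inv_cancel₀ gμ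
    simp only [div_eq_mul_inv]
    linear_combination (Gamma c * (Gamma (c+μ))⁻¹ * S) * this + (Gamma c * (Gamma (c+μ))⁻¹ * S *
      (cexp ((1-μ)*L2) * cexp ((c+μ-1)*L1) * cexp (-(c-a)*L2))) * g2
  · rw [uIoo_of_lt hx0]
    have hT := termwise hc hμ hx0 (_root_.hc a b c) (hc_summable _ _ _ _ hx0.le hx1)
    have hint : ∫ y in Ioo 0 x, ((|y| : ℝ) : ℂ) ^ (c - 1) * hypF a b c y *
          (((|x - y| : ℝ) : ℂ) ^ (μ - 1) / Complex.Gamma μ) = ∫ y in Ioo 0 x, (Gamma μ)⁻¹ *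
          ((y:ℂ)^(c-1) * (∑' n, _root_.hc a b c n * (y:ℂ)^n) * ((x:ℂ) - y)^(μ-1)) := by
      refine setIntegral_congr_fun measurableSet_Ioo fun y hy => ?_
      rw [abs_of_pos hy.1, abs_of_pos (sub_pos.2 hy.2), hypF, if_pos hy.1.le]
      simp only [_root_.hc]
      push_cast; ring
    rw [hint, integral_const_mul, hT, abs_of_pos hx0, hypF, if_pos hx0.le]
    have hcoef : ∀ n, _root_.hc a b c n * (poch c n / poch (c+μ) n) =
        poch a n * poch b n / (poch (c+μ) n * (Nat.factorial n : ℂ)) := by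
      intro n
      have := poch_ne hc1 n
      have := poch_ne hc2 n
      rw [_root_.hc]; field_simp
    simp only [hcoef]
    field_simp
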